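/- Deterministic bound on the difference between a complete matrix and its rescaled masked version: Let Y be an n×n real symmetric matrix of rank r with spectral decomposition Y = Σ_{k=1}^{r} λ_k(Y) v_k v_kᵀ (orthonormal v_k), and set τ := max_{i∈[n]} Σ_{k=1}^{r} v_{k,i}². Let G be an undirected graph on n vertices (loops allowed) with adjacency matrix A_G, algebraic connectivity φ(G) > 0 and irregularity ψ(G). Then ‖Y − (n/φ(G))·A_G ∘ Y‖₂ ≤ (n·τ·ψ(G)/φ(G))·‖Y‖₂, where ∘ denotes the Hadamard (entrywise) product and ‖·‖₂ the spectral norm. -/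

import Mathlib

open Matrix MeasureTheory ProbabilityTheory

noncomputable section

/-- Spectral norm (largest singular value) of a rectangular real matrix. -/
noncomputable def specNorm {m n : Type*} [Fintype m] [Fintype n] [DecidableEq n]
    (A : Matrix m n ℝ) : ℝ :=
  ‖LinearMap.toContinuousLinearMap (Matrix.toEuclideanLin A)‖

/-- Eigenvalues of a square real matrix, sorted in ascending order
(empty list if the matrix is not symmetric). -/
noncomputable def eigsAsc {ι : Type*} [Fintype ι] [DecidableEq ι]
    (A : Matrix ι ι ℝ) : List ℝ :=
  if hA : A.IsHermitian then (Finset.univ.val.map hA.eigenvalues).sort (· ≤ ·) else []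

/-- `k`-th largest eigenvalue (1-indexed) of a real symmetric matrix. -/
noncomputable def lamK {ι : Type*} [Fintype ι] [DecidableEq ι]
    (k : ℕ) (A : Matrix ι ι ℝ) : ℝ :=
  (eigsAsc A).getD (Fintype.card ι - k) 0

/-- `k`-th smallest eigenvalue (1-indexed) of a real symmetric matrix. -/
noncomputable def muK {ι : Type*} [Fintype ι] [DecidableEq ι]
    (k : ℕ) (A : Matrix ι ι ℝ) : ℝ :=
  (eigsAsc A).getD (k - 1) 0

/-- `A` is the adjacency matrix of an undirected graph (loops allowed):
symmetric with entries in `{0,1}`. -/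
def IsAdj {ι : Type*} (A : Matrix ι ι ℝ) : Prop :=
  A.IsSymm ∧ ∀ i j, A i j = 0 ∨ A i j = 1

/-- Degree of node `i`. -/
def deg {ι : Type*} [Fintype ι] (A : Matrix ι ι ℝ) (i : ι) : ℝ := ∑ j, A i j

/-- Maximum node degree. -/
noncomputable def maxDeg {ι : Type*} [Fintype ι] (A : Matrix ι ι ℝ) : ℝ := ⨆ i, deg A i

/-- Minimum node degree. -/
noncomputable def minDeg {ι : Type*} [Fintype ι] (A : Matrix ι ι ℝ) : ℝ := ⨅ i, deg A i

/-- Graph Laplacian `D - A`. -/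
noncomputable def lap {ι : Type*} [Fintype ι] [DecidableEq ι]
    (A : Matrix ι ι ℝ) : Matrix ι ι ℝ :=
  Matrix.diagonal (deg A) - A

/-- Algebraic connectivity: second-smallest Laplacian eigenvalue. -/
noncomputable def algConn {ι : Type*} [Fintype ι] [DecidableEq ι]
    (A : Matrix ι ι ℝ) : ℝ :=
  muK 2 (lap A)

/-- Adjacency matrix of the complement graph (with loops): `𝟙𝟙ᵀ - A`. -/
def graphCompl {ι : Type*} (A : Matrix ι ι ℝ) : Matrix ι ι ℝ :=
  Matrix.of fun i j => 1 - A i j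

/-- Irregularity `ψ(G) = max{Δmax(G) − φ(G), Δmax(Ḡ) − φ(Ḡ)}`. -/
noncomputable def irreg {ι : Type*} [Fintype ι] [DecidableEq ι]
    (A : Matrix ι ι ℝ) : ℝ :=
  max (maxDeg A - algConn A) (maxDeg (graphCompl A) - algConn (graphCompl A))

end

/-- At most one eigenvalue of a symmetric matrix lies strictly below a nonzero second-smallest
eigenvalue. -/
lemma eq_of_eigenvalues_lt_muK_two {ι : Type*} [Fintype ι] [DecidableEq ι]
    {L : Matrix ι ι ℝ} (hL : L.IsHermitian) (hpos : muK 2 L ≠ 0) :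
    ∀ i j, hL.eigenvalues i < muK 2 L → hL.eigenvalues j < muK 2 L → i = j := by
  classical
  have hsort := Multiset.sort_eq (Finset.univ.val.map hL.eigenvalues) (· ≤ ·)
  have hpair := Multiset.pairwise_sort (Finset.univ.val.map hL.eigenvalues) (· ≤ ·)
  have hmu : muK 2 L = ((Finset.univ.val.map hL.eigenvalues).sort (· ≤ ·)).getD 1 0 := by
    rw [muK, eigsAsc, dif_pos hL]
  generalize (Finset.univ.val.map hL.eigenvalues).sort (· ≤ ·) = l at hsort hpair hmu
  match l with
  | [] => simp [hmu] at hpos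
  | [a] => simp [hmu] at hpos
  | a :: b :: t =>
    have hb : muK 2 L = b := by simpa using hmu
    rw [hb]
    have hcount : Multiset.countP (· < b) (Finset.univ.val.map hL.eigenvalues) ≤ 1 := by
      rw [← hsort, Multiset.coe_countP, List.countP_cons, List.countP_cons]
      have ht : List.countP (fun x => decide (x < b)) t = 0 := by
        rw [List.countP_eq_zero]
        intro x hx
        simpa using (List.pairwise_cons.1 (List.pairwise_cons.1 hpair).2).1 x hx
      simp only [ht, lt_irrefl, decide_false]
      split <;> split <;> simp_all
    rw [Multiset.countP_map] at hcount
    intro i j hi hj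
    have := (Finset.card_le_one (s := Finset.univ.filter fun k => hL.eigenvalues k < b)).1 hcount
    exact this i (by simpa using hi) j (by simpa using hj)

/-- A positive semidefinite quadratic form with a kernel vector `w` dominates its second-smallest
eigenvalue on the orthogonal complement of `w`. -/
lemma muK_two_mul_dotProduct_le {ι : Type*} [Fintype ι] [DecidableEq ι]
    {L : Matrix ι ι ℝ} (hL : L.IsHermitian) (hpsd : ∀ x : ι → ℝ, 0 ≤ x ⬝ᵥ (L *ᵥ x))
    {w : ι → ℝ} (hw : L *ᵥ w = 0) (hw0 : w ≠ 0) {x : ι → ℝ} (hx : w ⬝ᵥ x = 0) :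
    muK 2 L * (x ⬝ᵥ x) ≤ x ⬝ᵥ (L *ᵥ x) := by
  rcases le_or_gt (muK 2 L) 0 with hmu | hmu
  · have h0 : 0 ≤ x ⬝ᵥ x := Finset.sum_nonneg fun i _ => mul_self_nonneg _
    exact (mul_nonpos_of_nonpos_of_nonneg hmu h0).trans (hpsd x)
  let c : ι → (ι → ℝ) → ℝ := fun i y => (hL.eigenvectorBasis i).ofLp ⬝ᵥ y
  have hparseval : ∀ y z : ι → ℝ, y ⬝ᵥ z = ∑ i, c i y * c i z := by
    intro y z
    have := hL.eigenvectorBasis.sum_inner_mul_inner (WithLp.toLp 2 y) (WithLp.toLp 2 z)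
    simp only [EuclideanSpace.inner_eq_star_dotProduct, star_trivial] at this
    rw [dotProduct_comm y z, ← this]
    refine Finset.sum_congr rfl fun i _ => ?_
    rw [dotProduct_comm z]
  have hmul : ∀ i y, c i (L *ᵥ y) = hL.eigenvalues i * c i y := by
    intro i y
    have hT : Lᵀ = L := by simpa [Matrix.IsHermitian, conjTranspose_eq_transpose_of_trivial] using hL
    simp only [c]
    rw [dotProduct_mulVec, ← mulVec_transpose, hT, hL.mulVec_eigenvectorBasis, smul_dotProduct,
      smul_eq_mul]
  have hcw : ∀ i, hL.eigenvalues i * c i w = 0 := fun i => by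
    rw [← hmul, hw]; simp [c]
  obtain ⟨i₀, hi₀⟩ : ∃ i, c i w ≠ 0 := by
    by_contra! h
    apply hw0
    have : w ⬝ᵥ w = 0 := by rw [hparseval]; simp [h]
    exact dotProduct_self_eq_zero.1 this
  have heig₀ : hL.eigenvalues i₀ = 0 := (mul_eq_zero.1 (hcw i₀)).resolve_right hi₀
  have hge : ∀ i, i ≠ i₀ → muK 2 L ≤ hL.eigenvalues i := by
    intro i hi
    by_contra! h
    exact hi (eq_of_eigenvalues_lt_muK_two hL hmu.ne' i i₀ h (by rwa [heig₀]))
  have hx₀ : c i₀ x = 0 := by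
    rw [hparseval, Finset.sum_eq_single i₀] at hx
    · exact (mul_eq_zero.1 hx).resolve_left hi₀
    · intro i _ hi
      have := (mul_eq_zero.1 (hcw i)).resolve_left (hmu.trans_le (hge i hi)).ne'
      simp [this]
    · simp
  rw [hparseval x x, hparseval x (L *ᵥ x), Finset.mul_sum]
  refine Finset.sum_le_sum fun i _ => ?_
  rw [hmul]
  rcases eq_or_ne i i₀ with rfl | hi
  · simp [hx₀]
  · nlinarith [hge i hi, mul_self_nonneg (c i x)]

lemma dotProduct_lap_mulVec {ι : Type*} [Fintype ι] [DecidableEq ι] (A : Matrix ι ι ℝ)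
    (x : ι → ℝ) : x ⬝ᵥ (lap A *ᵥ x) = ∑ i, deg A i * x i ^ 2 - x ⬝ᵥ (A *ᵥ x) := by
  rw [lap, sub_mulVec, dotProduct_sub]
  congr 1
  refine Finset.sum_congr rfl fun i _ => ?_
  rw [mulVec_diagonal]
  ring

lemma lap_isHermitian {ι : Type*} [Fintype ι] [DecidableEq ι] {A : Matrix ι ι ℝ}
    (hA : A.IsSymm) : (lap A).IsHermitian := by
  rw [Matrix.IsHermitian, conjTranspose_eq_transpose_of_trivial, lap, transpose_sub,
    diagonal_transpose, hA.eq]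

lemma lap_mulVec_one {ι : Type*} [Fintype ι] [DecidableEq ι] (A : Matrix ι ι ℝ) :
    lap A *ᵥ 1 = 0 := by
  ext i
  simp [lap, mulVec, dotProduct, diagonal_apply, deg]

lemma dotProduct_lap_mulVec_nonneg {ι : Type*} [Fintype ι] [DecidableEq ι] {A : Matrix ι ι ℝ}
    (hA : A.IsSymm) (h0 : ∀ i j, 0 ≤ A i j) (x : ι → ℝ) : 0 ≤ x ⬝ᵥ (lap A *ᵥ x) := by
  have hleft : ∑ i, deg A i * x i ^ 2 = ∑ i, ∑ j, A i j * x i ^ 2 := by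
    simp [deg, Finset.sum_mul]
  have hright : ∑ i, deg A i * x i ^ 2 = ∑ i, ∑ j, A i j * x j ^ 2 := by
    rw [hleft, Finset.sum_comm]
    refine Finset.sum_congr rfl fun i _ => Finset.sum_congr rfl fun j _ => ?_
    rw [hA.apply]
  have hform : x ⬝ᵥ (A *ᵥ x) = ∑ i, ∑ j, A i j * (x i * x j) := by
    simp only [dotProduct, mulVec, Finset.mul_sum]
    refine Finset.sum_congr rfl fun i _ => Finset.sum_congr rfl fun j _ => ?_
    ring
  have hsq : 0 ≤ ∑ i, ∑ j, A i j * (x i - x j) ^ 2 :=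
    Finset.sum_nonneg fun i _ => Finset.sum_nonneg fun j _ => mul_nonneg (h0 i j) (sq_nonneg _)
  have hexp : ∑ i, ∑ j, A i j * (x i - x j) ^ 2 =
      (∑ i, ∑ j, A i j * x i ^ 2) + (∑ i, ∑ j, A i j * x j ^ 2)
        - 2 * ∑ i, ∑ j, A i j * (x i * x j) := by
    simp only [Finset.mul_sum, ← Finset.sum_add_distrib, ← Finset.sum_sub_distrib]
    refine Finset.sum_congr rfl fun i _ => Finset.sum_congr rfl fun j _ => ?_
    ring
  rw [dotProduct_lap_mulVec, hform]
  linarith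

/-- The Laplacian form of a nonnegatively weighted graph dominates the algebraic connectivity times
the squared distance to the constant vectors. -/
lemma algConn_mul_le_dotProduct_lap_mulVec {ι : Type*} [Fintype ι] [DecidableEq ι] [Nonempty ι]
    {A : Matrix ι ι ℝ} (hA : A.IsSymm) (h0 : ∀ i j, 0 ≤ A i j) (x : ι → ℝ) :
    algConn A * (x ⬝ᵥ x - (∑ i, x i) ^ 2 / Fintype.card ι) ≤ x ⬝ᵥ (lap A *ᵥ x) := by
  have hcard : (Fintype.card ι : ℝ) ≠ 0 := by simp
  set s : ℝ := (∑ i, x i) / Fintype.card ι with hs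
  have hsum : ∑ i, x i = s * Fintype.card ι := by rw [hs]; field_simp
  have hx1 : x ⬝ᵥ (1 : ι → ℝ) = s * Fintype.card ι := by rw [dotProduct_one, hsum]
  have h11 : (1 : ι → ℝ) ⬝ᵥ (1 : ι → ℝ) = Fintype.card ι := by simp
  have hker : lap A *ᵥ (x - s • 1) = lap A *ᵥ x := by
    rw [mulVec_sub, mulVec_smul, lap_mulVec_one]; simp
  have hT : (lap A)ᵀ = lap A := by
    simpa [Matrix.IsHermitian, conjTranspose_eq_transpose_of_trivial] using lap_isHermitian hA
  have hone : (1 : ι → ℝ) ⬝ᵥ (lap A *ᵥ x) = 0 := by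
    rw [dotProduct_mulVec, ← mulVec_transpose, hT, lap_mulVec_one, zero_dotProduct]
  have key := muK_two_mul_dotProduct_le (lap_isHermitian hA) (dotProduct_lap_mulVec_nonneg hA h0)
    (lap_mulVec_one A) one_ne_zero (x := x - s • 1) (by
      rw [dotProduct_sub, dotProduct_smul, h11, dotProduct_comm, hx1, smul_eq_mul, sub_self])
  rw [hker, sub_dotProduct x (s • 1) (lap A *ᵥ x), smul_dotProduct s 1 (lap A *ᵥ x), hone,
    smul_zero, sub_zero] at key
  rw [algConn]
  convert key using 2
  rw [sub_dotProduct, dotProduct_sub, dotProduct_sub, smul_dotProduct, smul_dotProduct,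
    dotProduct_smul, dotProduct_smul, dotProduct_comm 1 x, hx1, h11, hsum]
  simp only [smul_eq_mul]
  field_simp
  ring

lemma nontrivial_of_algConn_ne_zero {ι : Type*} [Fintype ι] [DecidableEq ι]
    {A : Matrix ι ι ℝ} (h : algConn A ≠ 0) : Nontrivial ι := by
  rw [← Fintype.one_lt_card_iff_nontrivial]
  by_contra! hcard
  refine h (List.getD_eq_default _ _ (le_trans ?_ hcard))
  rw [eigsAsc]
  split_ifs <;> simp

lemma deg_graphCompl {ι : Type*} [Fintype ι] (A : Matrix ι ι ℝ) (i : ι) :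
    deg (graphCompl A) i = Fintype.card ι - deg A i := by
  simp [deg, graphCompl]

lemma deg_le_maxDeg {ι : Type*} [Fintype ι] (A : Matrix ι ι ℝ) (i : ι) :
    deg A i ≤ maxDeg A :=
  le_ciSup (Set.finite_range _).bddAbove i

lemma dotProduct_graphCompl_mulVec {ι : Type*} [Fintype ι] (A : Matrix ι ι ℝ) (x : ι → ℝ) :
    x ⬝ᵥ (graphCompl A *ᵥ x) = (∑ i, x i) ^ 2 - x ⬝ᵥ (A *ᵥ x) := by
  simp only [graphCompl, dotProduct, mulVec, of_apply, sub_mul, one_mul, Finset.sum_sub_distrib,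
    mul_sub, ← Finset.sum_mul, sq]

/-- The adjacency form differs from `φ(G)/n` times the all-ones form by at most `ψ(G)`. -/
lemma abs_dotProduct_mulVec_sub_le_irreg {ι : Type*} [Fintype ι] [DecidableEq ι] [Nontrivial ι]
    {A : Matrix ι ι ℝ} (hA : IsAdj A) (x : ι → ℝ) :
    |x ⬝ᵥ (A *ᵥ x) - algConn A / Fintype.card ι * (∑ i, x i) ^ 2| ≤ irreg A * (x ⬝ᵥ x) := by
  have hcard : (1 : ℝ) < Fintype.card ι := by exact_mod_cast Fintype.one_lt_card
  set N : ℝ := (Fintype.card ι : ℝ) with hN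
  have hA0 : ∀ i j, 0 ≤ A i j := fun i j => by rcases hA.2 i j with h | h <;> simp [h]
  have hB0 : ∀ i j, 0 ≤ graphCompl A i j := fun i j => by
    rcases hA.2 i j with h | h <;> simp [graphCompl, h]
  have hBsymm : (graphCompl A).IsSymm := by
    ext i j
    simp [graphCompl, hA.1.apply i j]
  have hQ := fun y : ι → ℝ => algConn_mul_le_dotProduct_lap_mulVec hA.1 hA0 y
  have hQ' := fun y : ι → ℝ => algConn_mul_le_dotProduct_lap_mulVec hBsymm hB0 y
  have hself : ∀ y : ι → ℝ, y ⬝ᵥ y = ∑ i, y i ^ 2 := fun y => by simp [dotProduct, sq]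
  have hcompl : ∀ y : ι → ℝ, y ⬝ᵥ (lap (graphCompl A) *ᵥ y) =
      N * (y ⬝ᵥ y) - (∑ i, y i) ^ 2 - y ⬝ᵥ (lap A *ᵥ y) := fun y => by
    rw [dotProduct_lap_mulVec, dotProduct_lap_mulVec, dotProduct_graphCompl_mulVec, hself]
    simp only [deg_graphCompl, sub_mul, Finset.sum_sub_distrib, ← Finset.mul_sum, ← hN]
    ring
  have hconn : algConn A + algConn (graphCompl A) ≤ N := by
    obtain ⟨i⟩ : Nonempty ι := inferInstance
    have h1 := hQ (Pi.single i 1)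
    have h2 := hQ' (Pi.single i 1)
    rw [hcompl] at h2
    have hs : ∑ j, (Pi.single i 1 : ι → ℝ) j = 1 := by simp
    have hd : (Pi.single i 1 : ι → ℝ) ⬝ᵥ Pi.single i 1 = 1 := by simp
    rw [hs, hd, ← hN] at h1 h2
    have hp : 0 < N - 1 := by linarith
    have h3 : (algConn A + algConn (graphCompl A)) * ((N - 1) / N) ≤ N * ((N - 1) / N) := by
      have e1 : N * ((N - 1) / N) = N - 1 := by field_simp
      have e2 : (N - 1) / N = 1 - 1 ^ 2 / N := by field_simp
      rw [e1, e2]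
      linarith
    exact le_of_mul_le_mul_right h3 (by positivity)
  have hupper : ∑ i, deg A i * x i ^ 2 ≤ maxDeg A * (x ⬝ᵥ x) := by
    rw [hself, Finset.mul_sum]
    exact Finset.sum_le_sum fun i _ => mul_le_mul_of_nonneg_right (deg_le_maxDeg A i) (sq_nonneg _)
  have hlower : (N - maxDeg (graphCompl A)) * (x ⬝ᵥ x) ≤ ∑ i, deg A i * x i ^ 2 := by
    rw [hself, Finset.mul_sum]
    refine Finset.sum_le_sum fun i _ => mul_le_mul_of_nonneg_right ?_ (sq_nonneg _)
    have := deg_le_maxDeg (graphCompl A) i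
    rw [deg_graphCompl] at this
    linarith
  have hx0 : 0 ≤ x ⬝ᵥ x := by rw [hself]; positivity
  have hform := dotProduct_lap_mulVec A x
  have h1 := hQ x
  have h2 := hQ' x
  rw [hcompl] at h2
  rw [← hN] at h1 h2
  have hψ1 := mul_le_mul_of_nonneg_right
    (le_max_left (maxDeg A - algConn A) (maxDeg (graphCompl A) - algConn (graphCompl A))) hx0
  have hψ2 := mul_le_mul_of_nonneg_right
    (le_max_right (maxDeg A - algConn A) (maxDeg (graphCompl A) - algConn (graphCompl A))) hx0
  rw [← irreg] at hψ1 hψ2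
  set q : ℝ := (∑ i, x i) ^ 2 / N with hq
  have hq0 : 0 ≤ q := by positivity
  have hqN : (∑ i, x i) ^ 2 = N * q := by rw [hq]; field_simp
  have hφq : algConn A / N * (∑ i, x i) ^ 2 = algConn A * q := by rw [hq]; ring
  rw [hqN] at h2
  rw [hφq, abs_le]
  have hgap := mul_le_mul_of_nonneg_right hconn hq0
  constructor <;> linarith

/-- The spectral norm of a symmetric matrix is bounded by any bound on its quadratic form. -/
lemma specNorm_le_of_abs_dotProduct_mulVec_le {ι : Type*} [Fintype ι] [DecidableEq ι]
    {B : Matrix ι ι ℝ} (hB : B.IsSymm) {c : ℝ} (hc : 0 ≤ c)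
    (h : ∀ x : ι → ℝ, |x ⬝ᵥ (B *ᵥ x)| ≤ c * (x ⬝ᵥ x)) : specNorm B ≤ c := by
  have hsymm : (LinearMap.toContinuousLinearMap (Matrix.toEuclideanLin B)).IsSymmetric :=
    isSymmetric_toEuclideanLin_iff.2 (by
      rwa [Matrix.IsHermitian, conjTranspose_eq_transpose_of_trivial])
  rw [specNorm, ContinuousLinearMap.norm_eq_iSup_rayleighQuotient _ hsymm]
  refine ciSup_le fun x => ?_
  rw [ContinuousLinearMap.rayleighQuotient, abs_div, abs_of_nonneg (sq_nonneg ‖x‖)]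
  refine div_le_of_le_mul₀ (sq_nonneg _) hc ?_
  have hx := h x.ofLp
  have hn : ‖x‖ ^ 2 = x.ofLp ⬝ᵥ x.ofLp := by
    rw [EuclideanSpace.norm_sq_eq]; simp [dotProduct, sq]
  rw [hn]
  simpa [ContinuousLinearMap.reApplyInnerSelf, EuclideanSpace.inner_eq_star_dotProduct] using hx

/-- A matrix `∑ k, lam k • v k (v k)ᵀ` with orthonormal `v` has `|lam k|` at most its spectral
norm. -/
lemma abs_le_specNorm_of_orthonormal {ι κ : Type*} [Fintype ι] [DecidableEq ι] [Fintype κ]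
    [DecidableEq κ] (lam : κ → ℝ) (v : κ → ι → ℝ)
    (horth : ∀ k l, (∑ i, v k i * v l i) = if k = l then (1 : ℝ) else 0) (k : κ) :
    |lam k| ≤ specNorm (∑ l, lam l • Matrix.vecMulVec (v l) (v l)) := by
  have heig : (∑ l, lam l • Matrix.vecMulVec (v l) (v l)) *ᵥ v k = lam k • v k := by
    have hdot : ∀ l, v l ⬝ᵥ v k = if l = k then (1 : ℝ) else 0 := fun l => horth l k
    simp [sum_mulVec, smul_mulVec, vecMulVec_mulVec, hdot]
  have hnorm : ‖WithLp.toLp 2 (v k)‖ = 1 := by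
    rw [EuclideanSpace.norm_eq, Real.sqrt_eq_one]
    simpa [sq] using horth k k
  have := (LinearMap.toContinuousLinearMap (Matrix.toEuclideanLin
    (∑ l, lam l • Matrix.vecMulVec (v l) (v l)))).le_opNorm (WithLp.toLp 2 (v k))
  rw [hnorm, mul_one, LinearMap.coe_toContinuousLinearMap', toLpLin_toLp,
    toLin'_apply, heig, WithLp.toLp_smul, norm_smul, hnorm, mul_one] at this
  exact this

/-- The form of a Hadamard product with `∑ k, lam k • v k (v k)ᵀ` is a combination of forms of the
other factor. -/
lemma dotProduct_hadamard_sum_vecMulVec_mulVec {ι κ : Type*} [Fintype ι] [Fintype κ]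
    (M : Matrix ι ι ℝ) (lam : κ → ℝ) (v : κ → ι → ℝ) (x : ι → ℝ) :
    x ⬝ᵥ ((M ⊙ ∑ k, lam k • Matrix.vecMulVec (v k) (v k)) *ᵥ x) =
      ∑ k, lam k * ((v k * x) ⬝ᵥ (M *ᵥ (v k * x))) := by
  simp only [dotProduct, mulVec, hadamard_apply, Matrix.sum_apply, Matrix.smul_apply,
    vecMulVec_apply, Pi.mul_apply, smul_eq_mul, Finset.mul_sum, Finset.sum_mul]
  rw [Finset.sum_comm (s := (Finset.univ : Finset κ))]
  refine Finset.sum_congr rfl fun i _ => ?_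
  rw [Finset.sum_comm (s := (Finset.univ : Finset κ))]
  refine Finset.sum_congr rfl fun j _ => Finset.sum_congr rfl fun k _ => ?_
  ring

/-- Deterministic bound on the difference between a complete symmetric matrix and its
rescaled masked version:
`‖Y − (n/φ(G))·A_G ∘ Y‖₂ ≤ (n·τ·ψ(G)/φ(G))·‖Y‖₂`. -/
theorem masked_matrix_diff_bound
    (n r : ℕ) (Y : Matrix (Fin n) (Fin n) ℝ) (hY : Y.IsSymm) (hrank : Y.rank = r)
    (lam : Fin r → ℝ) (v : Fin r → (Fin n → ℝ))
    (horth : ∀ k l, (∑ i, v k i * v l i) = if k = l then (1 : ℝ) else 0)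
    (hdecomp : Y = ∑ k, lam k • Matrix.vecMulVec (v k) (v k))
    (τ : ℝ) (hτ : τ = ⨆ i : Fin n, ∑ k, (v k i) ^ 2)
    (A : Matrix (Fin n) (Fin n) ℝ) (hA : IsAdj A) (hφ : 0 < algConn A) :
    specNorm (Y - ((n : ℝ) / algConn A) • Matrix.hadamard A Y) ≤
      ((n : ℝ) * τ * irreg A / algConn A) * specNorm Y := by
  have hnt : Nontrivial (Fin n) := nontrivial_of_algConn_ne_zero hφ.ne'
  obtain ⟨i₀⟩ : Nonempty (Fin n) := inferInstance
  have hn : (0 : ℝ) < n := by exact_mod_cast i₀.pos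
  have hY0 : 0 ≤ specNorm Y := norm_nonneg _
  have hτle : ∀ i, ∑ k, v k i ^ 2 ≤ τ := fun i => by
    rw [hτ]; exact le_ciSup (f := fun i => ∑ k, v k i ^ 2) (Set.finite_range _).bddAbove i
  have hτ0 : 0 ≤ τ := (Finset.sum_nonneg fun k _ => sq_nonneg (v k i₀)).trans (hτle i₀)
  set c : ℝ := n * irreg A / algConn A with hc
  have hψ0 : 0 ≤ irreg A := by
    have := (abs_nonneg _).trans (abs_dotProduct_mulVec_sub_le_irreg hA (Pi.single i₀ 1))
    simpa using this
  have hc0 : 0 ≤ c := by positivity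
  set M : Matrix (Fin n) (Fin n) ℝ := of fun i j => 1 - n / algConn A * A i j with hM
  have hMY : Y - ((n : ℝ) / algConn A) • Matrix.hadamard A Y = M ⊙ Y := by
    ext i j
    simp [hM]
    ring
  have hMform : ∀ y : Fin n → ℝ, |y ⬝ᵥ (M *ᵥ y)| ≤ c * (y ⬝ᵥ y) := fun y => by
    have hMy : y ⬝ᵥ (M *ᵥ y) = -(n / algConn A) *
        (y ⬝ᵥ (A *ᵥ y) - algConn A / n * (∑ i, y i) ^ 2) := by
      have h1 : y ⬝ᵥ (M *ᵥ y) = (∑ i, y i) ^ 2 - n / algConn A * (y ⬝ᵥ (A *ᵥ y)) := by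
        simp only [hM, dotProduct, mulVec, of_apply, sub_mul, one_mul, Finset.sum_sub_distrib,
          mul_sub, ← Finset.sum_mul, sq, mul_assoc, ← Finset.mul_sum, mul_left_comm (y _)]
      rw [h1]
      field_simp
      ring
    have := abs_dotProduct_mulVec_sub_le_irreg hA y
    rw [Fintype.card_fin] at this
    rw [hMy, abs_mul, abs_neg, abs_of_pos (by positivity)]
    calc _ ≤ n / algConn A * (irreg A * (y ⬝ᵥ y)) := by gcongr
      _ = c * (y ⬝ᵥ y) := by rw [hc]; ring
  have hsymm : (M ⊙ Y).IsSymm := by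
    ext i j
    simp [hM, hA.1.apply i j, hY.apply i j]
  have hbound : (n : ℝ) * τ * irreg A / algConn A * specNorm Y = specNorm Y * c * τ := by
    rw [hc]; ring
  rw [hMY, hbound]
  refine specNorm_le_of_abs_dotProduct_mulVec_le hsymm (by positivity) fun x => ?_
  have hlam : ∀ k, |lam k| ≤ specNorm Y := fun k => by
    rw [hdecomp]; exact abs_le_specNorm_of_orthonormal lam v horth k
  have hexpand : x ⬝ᵥ ((M ⊙ Y) *ᵥ x) = ∑ k, lam k * ((v k * x) ⬝ᵥ (M *ᵥ (v k * x))) := by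
    rw [hdecomp, dotProduct_hadamard_sum_vecMulVec_mulVec]
  rw [hexpand]
  calc |∑ k, lam k * ((v k * x) ⬝ᵥ (M *ᵥ (v k * x)))|
      ≤ ∑ k, |lam k| * |(v k * x) ⬝ᵥ (M *ᵥ (v k * x))| := by
        simpa only [abs_mul] using Finset.abs_sum_le_sum_abs
          (fun k => lam k * ((v k * x) ⬝ᵥ (M *ᵥ (v k * x)))) Finset.univ
    _ ≤ ∑ k, specNorm Y * (c * ((v k * x) ⬝ᵥ (v k * x))) :=
        Finset.sum_le_sum fun k _ => mul_le_mul (hlam k) (hMform _) (abs_nonneg _) hY0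
    _ = specNorm Y * c * ∑ i, (∑ k, v k i ^ 2) * x i ^ 2 := by
        simp only [← Finset.mul_sum, dotProduct, Pi.mul_apply, Finset.sum_mul]
        rw [Finset.sum_comm, mul_assoc]
        refine congrArg _ (congrArg _ (Finset.sum_congr rfl fun i _ =>
          Finset.sum_congr rfl fun k _ => ?_))
        ring
    _ ≤ specNorm Y * c * ∑ i, τ * x i ^ 2 := by
        gcongr with i
        exact hτle i
    _ = specNorm Y * c * τ * (x ⬝ᵥ x) := by
        rw [← Finset.mul_sum, ← mul_assoc]
        simp [dotProduct, sq]
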